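/- For every positive integer C there exist a constant D > 0 and N such that for all n ≥ N the following holds. Set k = k₀(n) − C. Then the probability that the random graph G_{n,1/2} contains a packing of k-cliques of size greater than D·n²/k³ is less than exp(−n²/k²); i.e., P( ν_k(G_{n,1/2}) > D n²/k³ ) < exp(−n²/k²). -/

import Mathlib

/-- `fExp n k` is the expected number of `k`-cliques in `G_{n,1/2}`,
i.e. `C(n,k) · 2^{-C(k,2)}`. -/
noncomputable def fExp (n k : ℕ) : ℝ := (n.choose k : ℝ) / 2 ^ (k.choose 2)

/-- `kZero n = min {k : fExp n k < 1}`. -/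
noncomputable def kZero (n : ℕ) : ℕ := sInf {k | fExp n k < 1}

/-- `P` is a packing of `k`-cliques in the graph `G` on `{1,…,n}`: a family of
`k`-element vertex subsets, each inducing a clique, any two sharing at most one vertex. -/
def IsCliquePacking (n k : ℕ) (G : SimpleGraph (Fin n)) (P : Finset (Finset (Fin n))) : Prop :=
  (∀ A ∈ P, A.card = k ∧ G.IsClique (A : Set (Fin n))) ∧
    ∀ A ∈ P, ∀ B ∈ P, A ≠ B → (A ∩ B).card ≤ 1

/-- `nuPack n k G` is the maximum size of a packing of `k`-cliques in `G`. -/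
noncomputable def nuPack (n k : ℕ) (G : SimpleGraph (Fin n)) : ℕ :=
  sSup {m | ∃ P, IsCliquePacking n k G P ∧ P.card = m}

/-- Probability of an event under the uniform random graph `G_{n,1/2}`. -/
noncomputable def prGraph (n : ℕ) (E : SimpleGraph (Fin n) → Prop) : ℝ :=
  (Nat.card {G : SimpleGraph (Fin n) // E G} : ℝ) / (Nat.card (SimpleGraph (Fin n)) : ℝ)

section KZero

theorem div_pow_le_choose {n k : ℕ} (h : k ≤ n) : ((n : ℝ) / k) ^ k ≤ n.choose k := by
  induction k generalizing n with
  | zero => simp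
  | succ k ih =>
    obtain ⟨n, rfl⟩ := Nat.exists_eq_add_of_lt h
    have hk : k ≤ k + n := by omega
    generalize k + n = N at *
    have h1 : ((N + 1 : ℕ) : ℝ) * N.choose k = (N + 1).choose (k + 1) * (k + 1 : ℕ) := by
      exact_mod_cast Nat.add_one_mul_choose_eq N k
    have h2 : (((N + 1 : ℕ) : ℝ) / (k + 1 : ℕ)) ^ k ≤ N.choose k := by
      rcases Nat.eq_zero_or_pos k with rfl | hk0
      · simp
      have hk0' : (0 : ℝ) < k := by exact_mod_cast hk0
      have hkN : (k : ℝ) ≤ N := by exact_mod_cast hk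
      have h3 : ((N + 1 : ℕ) : ℝ) / (k + 1 : ℕ) ≤ (N : ℝ) / k := by
        rw [div_le_div_iff₀ (by positivity) hk0']
        push_cast
        nlinarith
      exact (pow_le_pow_left₀ (by positivity) h3 k).trans (ih hk)
    rw [pow_succ, mul_div_assoc', div_le_iff₀ (by positivity), ← h1, mul_comm]
    gcongr

theorem choose_two_le_sq (j : ℕ) : j.choose 2 ≤ j * j := by
  rw [Nat.choose_two_right]
  exact (Nat.div_le_self _ _).trans (Nat.mul_le_mul_left _ (Nat.sub_le _ _))

theorem one_le_fExp {n j J : ℕ} (hj : j ≤ J) (hn : J * 2 ^ J ≤ n) : 1 ≤ fExp n j := by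
  rw [fExp, le_div_iff₀ (by positivity), one_mul]
  rcases Nat.eq_zero_or_pos j with rfl | hj0
  · simp
  have hj0' : (0 : ℝ) < j := by exact_mod_cast hj0
  have hjn : j * 2 ^ j ≤ n := le_trans (Nat.mul_le_mul hj (Nat.pow_le_pow_right two_pos hj)) hn
  have hle : j ≤ n := le_trans (Nat.le_mul_of_pos_right _ (by positivity)) hjn
  refine le_trans ?_ (div_pow_le_choose hle)
  calc (2 : ℝ) ^ (j.choose 2) ≤ 2 ^ (j * j) :=
        pow_le_pow_right₀ one_le_two (choose_two_le_sq j)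
    _ = (2 ^ j) ^ j := pow_mul _ _ _
    _ ≤ ((n : ℝ) / j) ^ j := by
        gcongr
        rw [le_div_iff₀ hj0', mul_comm]
        exact_mod_cast hjn

theorem fExp_two_mul_log_lt_one {n : ℕ} : fExp n (2 * Nat.log 2 n + 3) < 1 := by
  rw [fExp, div_lt_one (by positivity)]
  set L := Nat.log 2 n
  have h1 : n < 2 ^ (L + 1) := Nat.lt_pow_succ_log_self one_lt_two n
  have h2 : (2 * L + 3).choose 2 = (L + 1) * (2 * L + 3) := by
    rw [Nat.choose_two_right]
    apply Nat.div_eq_of_eq_mul_left two_pos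
    rw [show 2 * L + 3 - 1 = 2 * (L + 1) by omega]
    ring
  have h3 : n.choose (2 * L + 3) < 2 ^ ((2 * L + 3).choose 2) := by
    rw [h2, pow_mul]
    exact (Nat.choose_le_pow _ _).trans_lt (Nat.pow_lt_pow_left h1 (by omega))
  exact_mod_cast h3

theorem four_mul_sq_le_two_pow {L : ℕ} (hL : 12 ≤ L) : 4 * (2 * L + 3) ^ 2 ≤ 2 ^ L := by
  induction L, hL using Nat.le_induction with
  | base => norm_num
  | succ L hL ih =>
    rw [pow_succ 2 L]
    nlinarith

theorem kZero_bounds (J : ℕ) : ∃ N, ∀ n, N ≤ n →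
    J < kZero n ∧ 4 * kZero n ^ 2 ≤ n ∧ fExp n (kZero n) < 1 := by
  refine ⟨max (J * 2 ^ J) (2 ^ 12), fun n hn => ?_⟩
  have hmem : fExp n (kZero n) < 1 :=
    Nat.sInf_mem (s := {k | fExp n k < 1}) ⟨_, fExp_two_mul_log_lt_one⟩
  have hle : kZero n ≤ 2 * Nat.log 2 n + 3 := Nat.sInf_le fExp_two_mul_log_lt_one
  have hn12 : 2 ^ 12 ≤ n := (le_max_right _ _).trans hn
  have hL : 12 ≤ Nat.log 2 n := Nat.le_log_of_pow_le one_lt_two hn12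
  refine ⟨?_, ?_, hmem⟩
  · by_contra! h
    exact absurd hmem (not_lt.2 (one_le_fExp h ((le_max_left _ _).trans hn)))
  · calc 4 * kZero n ^ 2 ≤ 4 * (2 * Nat.log 2 n + 3) ^ 2 := by gcongr
      _ ≤ 2 ^ Nat.log 2 n := four_mul_sq_le_two_pow hL
      _ ≤ n := Nat.pow_log_le_self 2 (by omega)

theorem fExp_le_two_pow_mul_fExp_succ {n j : ℕ} (h : 2 * (j + 1) ≤ n) :
    fExp n j ≤ 2 ^ j * fExp n (j + 1) := by
  have h1 : n.choose j ≤ n.choose (j + 1) := by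
    have := Nat.choose_succ_right_eq n j
    by_contra! hlt
    have h3 : n.choose (j + 1) * (j + 1) < n.choose j * (n - j) :=
      Nat.mul_lt_mul_of_lt_of_le hlt (by omega) (by omega)
    omega
  have h2 : (j + 1).choose 2 = j + j.choose 2 := by
    rw [Nat.choose_succ_succ' j 1, Nat.choose_one_right]
  rw [fExp, fExp, h2, pow_add, mul_div_assoc', mul_div_mul_left _ _ (by positivity)]
  gcongr

theorem fExp_le_two_pow_mul_fExp_add {n a : ℕ} (i : ℕ) (h : 2 * (a + i) ≤ n) :
    fExp n a ≤ 2 ^ (i * (a + i)) * fExp n (a + i) := by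
  induction i with
  | zero => simp
  | succ i ih =>
    have hpos : 0 ≤ fExp n (a + i + 1) := by unfold fExp; positivity
    calc fExp n a ≤ 2 ^ (i * (a + i)) * fExp n (a + i) := ih (by omega)
      _ ≤ 2 ^ (i * (a + i)) * (2 ^ (a + i) * fExp n (a + i + 1)) := by
          gcongr
          exact fExp_le_two_pow_mul_fExp_succ (by omega)
      _ = 2 ^ ((i + 1) * (a + i)) * fExp n (a + i + 1) := by ring
      _ ≤ 2 ^ ((i + 1) * (a + (i + 1))) * fExp n (a + i + 1) := by
          gcongr
          · norm_num
          · omega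

end KZero

section Packing

open Finset

/-- The independence polynomial of the subgraph of `H` induced on `U`, evaluated at `y`. -/
noncomputable def indepPoly {V : Type*} [DecidableEq V] (H : SimpleGraph V)
    [DecidableRel H.Adj] (y : ℝ) (U : Finset V) : ℝ :=
  ∑ I ∈ U.powerset.filter (fun I : Finset V => H.IsIndepSet (I : Set V)), y ^ I.card

theorem indepPoly_le_exp_card {V : Type*} [DecidableEq V] (H : SimpleGraph V)
    [DecidableRel H.Adj] {y : ℝ} (hy : 0 ≤ y)
    (U : Finset V) : indepPoly H y U ≤ Real.exp (y * U.card) := by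
  calc indepPoly H y U ≤ ∑ I ∈ U.powerset, y ^ I.card :=
        sum_le_sum_of_subset_of_nonneg (filter_subset _ _) fun _ _ _ => by positivity
    _ = (1 + y) ^ U.card := by
        have h := prod_one_add (f := fun _ : V => y) U
        simp only [prod_const] at h
        exact h.symm
    _ ≤ Real.exp y ^ U.card := by
        gcongr
        linarith [Real.add_one_le_exp y]
    _ = Real.exp (y * U.card) := by rw [← Real.exp_nat_mul, mul_comm]

theorem indepPoly_le_erase_add {V : Type*} [DecidableEq V] (H : SimpleGraph V)
    [DecidableRel H.Adj] {y : ℝ} (hy : 0 ≤ y) (U : Finset V) (v : V) :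
    indepPoly H y U ≤
      indepPoly H y (U.erase v) + y * indepPoly H y {u ∈ U.erase v | ¬ H.Adj v u} := by
  unfold indepPoly
  rw [← sum_filter_add_sum_filter_not _ (fun I => v ∈ I), mul_sum, add_comm]
  refine add_le_add ?_ ?_
  · refine sum_le_sum_of_subset_of_nonneg ?_ fun _ _ _ => by positivity
    intro I hI
    rw [mem_filter, mem_filter, mem_powerset] at hI
    rw [mem_filter, mem_powerset]
    exact ⟨subset_erase.2 ⟨hI.1.1, hI.2⟩, hI.1.2⟩
  · set T := (U.powerset.filter (fun I : Finset V => H.IsIndepSet (I : Set V))).filter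
      (fun I => v ∈ I) with hT
    have hTmem : ∀ I ∈ T, (I ⊆ U ∧ H.IsIndepSet (I : Set V)) ∧ v ∈ I := by
      intro I hI
      rwa [hT, mem_filter, mem_filter, mem_powerset] at hI
    have hinj : Set.InjOn (fun I : Finset V => I.erase v) (T : Set (Finset V)) := by
      intro I hI J hJ h
      have h' : I.erase v = J.erase v := h
      rw [← insert_erase (hTmem I hI).2, h', insert_erase (hTmem J hJ).2]
    calc ∑ I ∈ T, y ^ I.card = ∑ I ∈ T, y * y ^ (I.erase v).card := by
            refine sum_congr rfl fun I hI => ?_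
            have := card_erase_add_one (hTmem I hI).2
            rw [← this, pow_succ']
      _ = ∑ J ∈ T.image (fun I => I.erase v), y * y ^ J.card :=
            (sum_image (f := fun J : Finset V => y * y ^ J.card) hinj).symm
      _ ≤ _ := by
            refine sum_le_sum_of_subset_of_nonneg ?_ fun _ _ _ => by positivity
            intro J hJ
            obtain ⟨I, hI, rfl⟩ := mem_image.1 hJ
            obtain ⟨⟨h1, h2⟩, h3⟩ := hTmem I hI
            rw [mem_filter, mem_powerset]
            refine ⟨fun u hu => ?_, fun a ha b hb => ?_⟩
            · rw [mem_erase] at hu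
              rw [mem_filter, mem_erase]
              exact ⟨⟨hu.1, h1 hu.2⟩, h2 h3 hu.2 hu.1.symm⟩
            · exact h2 (mem_of_mem_erase ha) (mem_of_mem_erase hb)

/-- If every subset of `S` of size larger than `s` contains a vertex of degree at least `Δ`
within it, then the independence polynomial on `S` is small. -/
theorem indepPoly_le_exp {V : Type*} [DecidableEq V] (H : SimpleGraph V) [DecidableRel H.Adj]
    {y s θ Δ : ℝ} (hy : 0 ≤ y) (hθ : 0 ≤ θ)
    (hrec : Real.exp (-θ) + y * Real.exp (-(θ * Δ)) ≤ 1) (S : Finset V)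
    (hS : ∀ U ⊆ S, s < U.card → ∃ v ∈ U, Δ ≤ (#{u ∈ U | H.Adj v u} : ℝ)) :
    indepPoly H y S ≤ Real.exp (y * s + θ * S.card) := by
  induction S using Finset.strongInduction with
  | H S ih =>
  by_cases hs : s < S.card
  · obtain ⟨v, hv, hd⟩ := hS S subset_rfl hs
    have h1 := ih (S.erase v) (erase_ssubset hv)
      fun U hU => hS U (hU.trans (erase_subset v S))
    have hsub : {u ∈ S.erase v | ¬ H.Adj v u} ⊂ S :=
      (filter_subset _ _).trans_ssubset (erase_ssubset hv)
    have h2 := ih _ hsub fun U hU => hS U (hU.trans hsub.1)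
    have hc1 : ((S.erase v).card : ℝ) = S.card - 1 := by
      rw [card_erase_of_mem hv, Nat.cast_sub (card_pos.2 ⟨v, hv⟩), Nat.cast_one]
    have hc2 : (#{u ∈ S.erase v | ¬ H.Adj v u} : ℝ) ≤ S.card - Δ := by
      have h3 : #{u ∈ S | H.Adj v u} + #{u ∈ S | ¬ H.Adj v u} = S.card :=
        card_filter_add_card_filter_not _
      have h4 : #{u ∈ S.erase v | ¬ H.Adj v u} ≤ #{u ∈ S | ¬ H.Adj v u} :=
        card_le_card (filter_subset_filter _ (erase_subset v S))
      have h3' : (#{u ∈ S | H.Adj v u} : ℝ) + #{u ∈ S | ¬ H.Adj v u} = S.card := by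
        exact_mod_cast h3
      have h4' : (#{u ∈ S.erase v | ¬ H.Adj v u} : ℝ) ≤ #{u ∈ S | ¬ H.Adj v u} := by
        exact_mod_cast h4
      linarith
    calc indepPoly H y S
        ≤ indepPoly H y (S.erase v) + y * indepPoly H y {u ∈ S.erase v | ¬ H.Adj v u} :=
          indepPoly_le_erase_add H hy S v
      _ ≤ Real.exp (y * s + θ * (S.card - 1)) + y * Real.exp (y * s + θ * (S.card - Δ)) := by
          refine add_le_add (h1.trans_eq (by rw [hc1])) ?_
          refine mul_le_mul_of_nonneg_left (h2.trans ?_) hy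
          gcongr
      _ = Real.exp (y * s + θ * S.card) * (Real.exp (-θ) + y * Real.exp (-(θ * Δ))) := by
          rw [mul_add, mul_left_comm, ← Real.exp_add, ← Real.exp_add]
          ring_nf
      _ ≤ Real.exp (y * s + θ * S.card) :=
          mul_le_of_le_one_right (Real.exp_pos _).le hrec
  · refine (indepPoly_le_exp_card H hy S).trans ?_
    gcongr
    have : 0 ≤ θ * S.card := by positivity
    nlinarith [not_lt.1 hs]

end Packing

section PackingLists

open Finset

variable {V : Type*} [DecidableEq V]

/-- The number of members of `l` containing `v`. -/
def coverDegree (l : List (Finset V)) (v : V) : ℕ := (l.map fun A => if v ∈ A then 1 else 0).sum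

/-- The number of members of `l` that contain `v` and are preceded by at least `δ` members
containing `v` (lists grow at the head). -/
noncomputable def heavyHits (δ : ℝ) : List (Finset V) → V → ℕ
  | [], _ => 0
  | A :: l, v => heavyHits δ l v + if v ∈ A ∧ δ ≤ coverDegree l v then 1 else 0

/-- The graph of pairs covered by a member of `l`. -/
def coverGraph (l : List (Finset V)) : SimpleGraph V where
  Adj u v := u ≠ v ∧ ∃ A ∈ l, u ∈ A ∧ v ∈ A
  symm := ⟨fun _ _ h => ⟨h.1.symm, h.2.imp fun _ hA => ⟨hA.1, hA.2.2, hA.2.1⟩⟩⟩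
  loopless := ⟨fun _ h => h.1 rfl⟩

instance (l : List (Finset V)) : DecidableRel (coverGraph l).Adj := fun u v =>
  inferInstanceAs (Decidable (u ≠ v ∧ ∃ A ∈ l, u ∈ A ∧ v ∈ A))

theorem coverDegree_cons (A : Finset V) (l : List (Finset V)) (v : V) :
    coverDegree (A :: l) v = (if v ∈ A then 1 else 0) + coverDegree l v := by
  simp [coverDegree]

theorem coverDegree_le_heavyHits_add {δ : ℝ} (hδ : 0 ≤ δ) (l : List (Finset V)) (v : V) :
    (coverDegree l v : ℝ) ≤ heavyHits δ l v + (δ + 1) := by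
  induction l with
  | nil =>
    simp only [coverDegree, heavyHits, List.map_nil, List.sum_nil, Nat.cast_zero]
    linarith
  | cons A l ih =>
    rw [coverDegree_cons, heavyHits]
    by_cases hv : v ∈ A
    · by_cases hd : δ ≤ coverDegree l v
      · simp only [hv, hd, and_self, if_true]
        push_cast
        linarith
      · simp only [hv, hd, and_false, if_true, if_false]
        push_cast
        have : (0 : ℝ) ≤ heavyHits δ l v := by positivity
        linarith [not_le.1 hd]
    · simpa [hv] using ih

theorem le_sum_coverGraph_degree (U : Finset V) (r : ℝ) {l : List (Finset V)}
    (hl : l.Pairwise fun A B => #(A ∩ B) ≤ 1) :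
    (2 * r - 1) * ∑ v ∈ U, (coverDegree l v : ℝ) - r ^ 2 * l.length ≤
      ∑ v ∈ U, (#{u ∈ U | (coverGraph l).Adj v u} : ℝ) := by
  induction l with
  | nil =>
    simp only [coverDegree, List.map_nil, List.sum_nil, List.length_nil, Nat.cast_zero,
      sum_const_zero, mul_zero, sub_zero]
    positivity
  | cons A l ih =>
    rw [List.pairwise_cons] at hl
    have hstep : ∀ v ∈ U, (#{u ∈ U | (coverGraph l).Adj v u} : ℝ) +
        (if v ∈ A then (#(A ∩ U) : ℝ) - 1 else 0) ≤
          #{u ∈ U | (coverGraph (A :: l)).Adj v u} := by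
      intro v hv
      have hmono : {u ∈ U | (coverGraph l).Adj v u} ⊆ {u ∈ U | (coverGraph (A :: l)).Adj v u} := by
        intro u
        simp only [mem_filter]
        exact fun h => ⟨h.1, h.2.1, h.2.2.imp fun B hB => ⟨List.mem_cons_of_mem _ hB.1, hB.2⟩⟩
      by_cases hvA : v ∈ A
      · have hdisj : Disjoint {u ∈ U | (coverGraph l).Adj v u} ((A ∩ U).erase v) := by
          refine disjoint_left.2 fun u hu hu' => ?_
          simp only [mem_filter] at hu
          rw [mem_erase, mem_inter] at hu'
          obtain ⟨-, -, B, hB, hvB, huB⟩ := hu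
          refine absurd (hl.1 B hB) (not_le.2 (one_lt_card.2 ⟨u, ?_, v, ?_, hu'.1⟩))
          · exact mem_inter.2 ⟨hu'.2.1, huB⟩
          · exact mem_inter.2 ⟨hvA, hvB⟩
        have hsub : {u ∈ U | (coverGraph l).Adj v u} ∪ (A ∩ U).erase v ⊆
            {u ∈ U | (coverGraph (A :: l)).Adj v u} := by
          refine union_subset hmono fun u hu => ?_
          rw [mem_erase, mem_inter] at hu
          rw [mem_filter]
          exact ⟨hu.2.2, hu.1.symm, A, List.mem_cons_self, hvA, hu.2.1⟩
        have h1 := card_le_card hsub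
        rw [card_union_of_disjoint hdisj] at h1
        have h2 := card_erase_add_one (mem_inter.2 ⟨hvA, hv⟩)
        have h1' : (#{u ∈ U | (coverGraph l).Adj v u} : ℝ) + #((A ∩ U).erase v) ≤
          #{u ∈ U | (coverGraph (A :: l)).Adj v u} := by exact_mod_cast h1
        have h2' : (#((A ∩ U).erase v) : ℝ) + 1 = #(A ∩ U) := by exact_mod_cast h2
        rw [if_pos hvA]
        linarith
      · rw [if_neg hvA, add_zero]
        exact_mod_cast card_le_card hmono
    have hsum := sum_le_sum hstep
    rw [sum_add_distrib, sum_ite_mem, sum_const, nsmul_eq_mul, inter_comm U A] at hsum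
    have hdeg : ∑ v ∈ U, (coverDegree (A :: l) v : ℝ) =
        #(A ∩ U) + ∑ v ∈ U, (coverDegree l v : ℝ) := by
      simp only [coverDegree_cons]
      push_cast
      rw [sum_add_distrib, sum_ite_mem, sum_const, nsmul_eq_mul, mul_one, inter_comm U A]
    have hih := ih hl.2
    rw [hdeg, List.length_cons]
    push_cast
    nlinarith [sq_nonneg ((#(A ∩ U) : ℝ) - r)]

/-- A large set of vertices of large cover degree contains a vertex of large degree within it. -/
theorem exists_le_coverGraph_degree {U : Finset V} {r s δ : ℝ} {l : List (Finset V)}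
    (hl : l.Pairwise fun A B => #(A ∩ B) ≤ 1) (hr : 1 / 2 ≤ r) (hδ : 0 ≤ δ)
    (hU : ∀ v ∈ U, δ ≤ coverDegree l v) (hs : 0 ≤ s) (hsU : s < #U)
    (hlen : r * l.length ≤ s * δ) :
    ∃ v ∈ U, (r - 1) * δ ≤ (#{u ∈ U | (coverGraph l).Adj v u} : ℝ) := by
  have hne : U.Nonempty := card_pos.1 (by exact_mod_cast hs.trans_lt hsU)
  refine exists_le_of_sum_le hne (le_trans ?_ (le_sum_coverGraph_degree U r hl))
  have h1 : (#U : ℝ) * δ ≤ ∑ v ∈ U, (coverDegree l v : ℝ) := by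
    rw [← nsmul_eq_mul]
    exact card_nsmul_le_sum U _ _ hU
  rw [sum_const, nsmul_eq_mul]
  have h2 : (2 * r - 1) * (#U * δ) ≤ (2 * r - 1) * ∑ v ∈ U, (coverDegree l v : ℝ) :=
    mul_le_mul_of_nonneg_left h1 (by linarith)
  have h3 : r * l.length ≤ #U * δ := hlen.trans (by gcongr)
  have h4 : r * (r * l.length) ≤ r * (#U * δ) := mul_le_mul_of_nonneg_left h3 (by linarith)
  linarith

/-- The lists of `t` sets of size `k` that pairwise share at most one vertex. -/
def packingLists [Fintype V] (k : ℕ) : ℕ → Finset (List (Finset V))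
  | 0 => {[]}
  | t + 1 => (packingLists k t).biUnion fun l =>
      ((powersetCard k univ).filter fun A => ∀ B ∈ l, #(A ∩ B) ≤ 1).image fun A => A :: l

variable [Fintype V]

theorem mem_packingLists {k t : ℕ} {l : List (Finset V)} :
    l ∈ packingLists k t ↔ l.length = t ∧ (∀ A ∈ l, #A = k) ∧
      l.Pairwise fun A B => #(A ∩ B) ≤ 1 := by
  induction t generalizing l with
  | zero =>
    rw [packingLists, mem_singleton, List.length_eq_zero_iff]
    constructor
    · rintro rfl
      simp
    · exact fun h => h.1
  | succ t ih =>
    simp only [packingLists, mem_biUnion, mem_image, mem_filter, mem_powersetCard_univ]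
    constructor
    · rintro ⟨l, hl, A, ⟨hA, hAl⟩, rfl⟩
      obtain ⟨h1, h2, h3⟩ := ih.1 hl
      refine ⟨by simp [h1], ?_, List.pairwise_cons.2 ⟨hAl, h3⟩⟩
      simpa [hA] using h2
    · rintro ⟨h1, h2, h3⟩
      cases l with
      | nil => simp at h1
      | cons A l =>
        rw [List.pairwise_cons] at h3
        rw [List.forall_mem_cons] at h2
        exact ⟨l, ih.2 ⟨by simpa using h1, h2.2, h3.2⟩, A, ⟨h2.1, h3.1⟩, rfl⟩

theorem sum_packingLists_succ (k t : ℕ) (g : List (Finset V) → ℝ) :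
    ∑ l ∈ packingLists k (t + 1), g l =
      ∑ l ∈ packingLists k t, ∑ A ∈ powersetCard k univ with ∀ B ∈ l, #(A ∩ B) ≤ 1,
        g (A :: l) := by
  rw [packingLists, sum_biUnion]
  · refine sum_congr rfl fun l _ => sum_image fun A _ B _ h => ?_
    exact (List.cons.inj h).1
  · intro l _ l' _ hne
    refine disjoint_left.2 fun x hx hx' => hne ?_
    obtain ⟨A, -, rfl⟩ := mem_image.1 hx
    obtain ⟨B, -, h⟩ := mem_image.1 hx'
    exact (List.cons.inj h).2.symm

theorem sum_coverDegree {k t : ℕ} {l : List (Finset V)} (hl : l ∈ packingLists k t) :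
    ∑ v, coverDegree l v = t * k := by
  induction t generalizing l with
  | zero =>
    rw [packingLists, mem_singleton] at hl
    simp [hl, coverDegree]
  | succ t ih =>
    simp only [packingLists, mem_biUnion, mem_image, mem_filter, mem_powersetCard_univ] at hl
    obtain ⟨l, hl, A, ⟨hA, -⟩, rfl⟩ := hl
    simp only [coverDegree_cons]
    rw [sum_add_distrib, ih hl, sum_ite_mem, univ_inter, sum_const, hA]
    simp
    ring

/-- The weighted number of extensions of a packing is controlled by an independence polynomial. -/
theorem sum_extensions_le (k : ℕ) {B z : ℝ} (hB : 0 ≤ B) (hz : 0 < z) (l : List (Finset V))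
    (S : Finset V) :
    ∑ A ∈ powersetCard k univ with ∀ B ∈ l, #(A ∩ B) ≤ 1, B ^ #(A ∩ S) ≤
      (z ^ k)⁻¹ * (Real.exp (z * Fintype.card V) * indepPoly (coverGraph l) (B * z) S) := by
  set T : Finset (Finset V) := {A ∈ powersetCard k univ | ∀ B ∈ l, #(A ∩ B) ≤ 1} with hT
  set I := S.powerset.filter fun J : Finset V => (coverGraph l).IsIndepSet (J : Set V) with hI
  have hbound : ∑ A ∈ T, z ^ k * B ^ #(A ∩ S) ≤
      ∑ p ∈ (univ : Finset V).powerset ×ˢ I, z ^ #p.1 * (B * z) ^ #p.2 := by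
    have hinj : Set.InjOn (fun A : Finset V => (A \ S, A ∩ S)) (T : Set (Finset V)) := by
      intro A _ A' _ h
      have h' := Prod.mk.inj h
      rw [← sdiff_union_inter A S, h'.1, h'.2, sdiff_union_inter]
    calc ∑ A ∈ T, z ^ k * B ^ #(A ∩ S) = ∑ A ∈ T, z ^ #(A \ S) * (B * z) ^ #(A ∩ S) := by
          refine sum_congr rfl fun A hA => ?_
          rw [hT, mem_filter, mem_powersetCard_univ] at hA
          rw [← hA.1, ← card_sdiff_add_card_inter A S, pow_add, mul_pow]
          ring
      _ = ∑ p ∈ T.image (fun A : Finset V => (A \ S, A ∩ S)), z ^ #p.1 * (B * z) ^ #p.2 :=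
          (sum_image (f := fun p : Finset V × Finset V => z ^ #p.1 * (B * z) ^ #p.2) hinj).symm
      _ ≤ _ := by
          refine sum_le_sum_of_subset_of_nonneg ?_ fun _ _ _ => by positivity
          intro p hp
          obtain ⟨A, hA, rfl⟩ := mem_image.1 hp
          rw [hT, mem_filter] at hA
          rw [mem_product, hI, mem_filter, mem_powerset, mem_powerset]
          refine ⟨subset_univ _, inter_subset_right, fun u hu v hv hne hadj => ?_⟩
          obtain ⟨-, C, hC, huC, hvC⟩ := hadj
          refine absurd (hA.2 C hC) (not_le.2 (one_lt_card.2 ⟨u, ?_, v, ?_, hne⟩))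
          · exact mem_inter.2 ⟨mem_of_mem_inter_left hu, huC⟩
          · exact mem_inter.2 ⟨mem_of_mem_inter_left hv, hvC⟩
  have hfull : ∑ A ∈ (univ : Finset V).powerset, z ^ #A ≤ Real.exp (z * Fintype.card V) := by
    have h := prod_one_add (f := fun _ : V => z) univ
    simp only [prod_const] at h
    rw [← h, mul_comm, Real.exp_nat_mul, card_univ]
    gcongr
    linarith [Real.add_one_le_exp z]
  rw [← mul_sum, sum_product] at hbound
  dsimp only at hbound
  rw [← sum_mul_sum] at hbound
  rw [← div_eq_inv_mul, le_div_iff₀' (by positivity)]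
  refine hbound.trans ?_
  unfold indepPoly
  gcongr

/-- The vertices covered at least `δ` times. -/
noncomputable def heavyVertices (δ : ℝ) (l : List (Finset V)) : Finset V :=
  {v | δ ≤ coverDegree l v}

theorem sum_heavyHits_cons (δ : ℝ) (A : Finset V) (l : List (Finset V)) :
    ∑ v, heavyHits δ (A :: l) v = ∑ v, heavyHits δ l v + #(A ∩ heavyVertices δ l) := by
  simp only [heavyHits]
  rw [sum_add_distrib, ← card_filter]
  congr 2
  ext v
  simp [heavyVertices]

theorem sum_pow_heavyHits_le {k m : ℕ} {B δ K : ℝ} (hB : 0 ≤ B) (hK : 0 ≤ K)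
    (h : ∀ t < m, ∀ l ∈ packingLists (V := V) k t,
      ∑ A ∈ powersetCard k univ with ∀ B ∈ l, #(A ∩ B) ≤ 1, B ^ #(A ∩ heavyVertices δ l) ≤ K) :
    ∑ l ∈ packingLists (V := V) k m, B ^ (∑ v, heavyHits δ l v) ≤ K ^ m := by
  induction m with
  | zero => simp [packingLists, heavyHits]
  | succ m ih =>
    rw [sum_packingLists_succ]
    calc _ = ∑ l ∈ packingLists (V := V) k m, B ^ (∑ v, heavyHits δ l v) *
          ∑ A ∈ powersetCard k univ with ∀ B ∈ l, #(A ∩ B) ≤ 1,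
            B ^ #(A ∩ heavyVertices δ l) := by
          refine sum_congr rfl fun l _ => ?_
          rw [mul_sum]
          exact sum_congr rfl fun A _ => by rw [sum_heavyHits_cons, pow_add]
      _ ≤ ∑ l ∈ packingLists (V := V) k m, B ^ (∑ v, heavyHits δ l v) * K := by
          gcongr with l hl
          exact h m (Nat.lt_succ_self m) l hl
      _ ≤ K ^ m * K := by
          rw [← sum_mul]
          gcongr
          exact ih fun t ht => h t (ht.trans (Nat.lt_succ_self m))
      _ = K ^ (m + 1) := (pow_succ K m).symm

end PackingLists

section Counting

open Finset

theorem exp_neg_add_mul_exp_neg_le_one {x B : ℝ} (hx : 0 ≤ x) (hx1 : x ≤ 1) :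
    Real.exp (-x) + B * x * Real.exp (-(2 * B)) ≤ 1 := by
  have h1 : Real.exp (-x) ≤ 1 - x / 2 := by
    rw [Real.exp_neg, inv_le_iff_one_le_mul₀ (Real.exp_pos x)]
    have h := mul_le_mul_of_nonneg_left (Real.add_one_le_exp x) (by linarith : 0 ≤ 1 - x / 2)
    nlinarith
  have h2 : B * Real.exp (-(2 * B)) ≤ 1 / 2 := by
    rw [Real.exp_neg, ← div_eq_mul_inv, div_le_iff₀ (Real.exp_pos _)]
    linarith [Real.add_one_le_exp (2 * B)]
  nlinarith

theorem coverGraph_le {V : Type*} {G : SimpleGraph V} {l : List (Finset V)}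
    (h : ∀ A ∈ l, G.IsClique (A : Set V)) : coverGraph l ≤ G := by
  rintro u v ⟨hne, A, hA, hu, hv⟩
  exact h A hA hu hv hne

variable {V : Type*} [DecidableEq V] [Fintype V]

theorem sum_extensions_heavyVertices_le {k t : ℕ} {B : ℝ} (hB : 1 ≤ B) (hk : 8 * B ≤ k)
    (hkV : k ≤ Fintype.card V) {l : List (Finset V)} (hl : l ∈ packingLists k t)
    (ht : (t : ℝ) ≤ 64 * B ^ 2 * (Fintype.card V : ℝ) ^ 2 / (k : ℝ) ^ 3) :
    ∑ A ∈ powersetCard k univ with ∀ B ∈ l, #(A ∩ B) ≤ 1,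
        B ^ #(A ∩ heavyVertices (16 * B ^ 2 * Fintype.card V / (k : ℝ) ^ 2) l) ≤
      (Fintype.card V).choose k * Real.exp (3 * k) := by
  obtain ⟨hlen, -, hpw⟩ := mem_packingLists.1 hl
  have hk0 : (0 : ℝ) < k := by linarith
  have hn0 : (0 : ℝ) < Fintype.card V := hk0.trans_le (by exact_mod_cast hkV)
  have hkn : (k : ℝ) / Fintype.card V ≤ 1 := by
    rw [div_le_one hn0]
    exact_mod_cast hkV
  set n : ℝ := (Fintype.card V : ℝ) with hn
  set δ : ℝ := 16 * B ^ 2 * n / (k : ℝ) ^ 2 with hδ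
  have hB0 : 0 < B := by linarith
  set S := heavyVertices δ l with hS
  have hdeg : ∀ U ⊆ S, n / B < #U →
      ∃ v ∈ U, 2 * B * n / k ≤ (#{u ∈ U | (coverGraph l).Adj v u} : ℝ) := by
    intro U hU hUs
    have hr : 1 / 2 ≤ (k : ℝ) / (4 * B) := by
      rw [le_div_iff₀ (by positivity)]
      linarith
    have hUδ : ∀ v ∈ U, δ ≤ coverDegree l v := by
      intro v hv
      have := hU hv
      rw [hS, heavyVertices, mem_filter] at this
      exact this.2
    have hlen' : (k : ℝ) / (4 * B) * l.length ≤ n / B * δ := by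
      rw [hlen]
      calc (k : ℝ) / (4 * B) * t ≤ k / (4 * B) * (64 * B ^ 2 * n ^ 2 / (k : ℝ) ^ 3) := by gcongr
        _ = n / B * δ := by
          rw [hδ]
          field_simp
          norm_num
    obtain ⟨v, hv, h⟩ := exists_le_coverGraph_degree hpw hr (by positivity) hUδ
      (by positivity) hUs hlen'
    refine ⟨v, hv, le_trans ?_ h⟩
    have h1 : (k : ℝ) / (8 * B) ≤ k / (4 * B) - 1 := by
      rw [div_le_iff₀ (by positivity), sub_mul, div_mul_eq_mul_div, le_sub_iff_add_le,
        le_div_iff₀ (by positivity)]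
      nlinarith
    calc 2 * B * n / k = k / (8 * B) * δ := by
          rw [hδ]
          field_simp
          norm_num
      _ ≤ _ := by gcongr
  have hpoly := indepPoly_le_exp (coverGraph l) (y := B * (k / n)) (s := n / B) (θ := k / n)
    (Δ := 2 * B * n / k) (by positivity) (by positivity)
    (by
      have h := exp_neg_add_mul_exp_neg_le_one (B := B) (by positivity) hkn
      have h2 : (k : ℝ) / n * (2 * B * n / k) = 2 * B := by field_simp
      rwa [h2]) S hdeg
  have hcard : (#S : ℝ) ≤ n := by
    rw [hn]
    exact_mod_cast card_le_univ S
  have hexp : B * (k / n) * (n / B) + k / n * #S ≤ 2 * k := by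
    calc B * (k / n) * (n / B) + k / n * #S ≤ B * (k / n) * (n / B) + k / n * n := by gcongr
      _ = 2 * k := by
        field_simp
        norm_num
  have hchoose := div_pow_le_choose hkV
  calc _ ≤ (((k : ℝ) / n) ^ k)⁻¹ *
        (Real.exp (k / n * n) * indepPoly (coverGraph l) (B * (k / n)) S) :=
        sum_extensions_le k hB0.le (by positivity) l S
    _ ≤ ((n / k) ^ k) * (Real.exp k * Real.exp (2 * k)) := by
        rw [← inv_pow, inv_div, div_mul_cancel₀ _ hn0.ne']
        gcongr
        exact hpoly.trans (Real.exp_le_exp.2 hexp)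
    _ ≤ _ := by
        rw [← Real.exp_add, show (k : ℝ) + 2 * k = 3 * k by ring]
        gcongr

theorem card_packingLists_mul_le {k m : ℕ} {E : ℝ} (hE : 1 ≤ E) (hk : 8 * E ^ 2 ≤ k)
    (hkV : 4 * k ^ 2 ≤ Fintype.card V)
    (hm : 64 * (E ^ 2) ^ 2 * (Fintype.card V : ℝ) ^ 2 / (k : ℝ) ^ 3 ≤ m)
    (hm' : ∀ t < m, (t : ℝ) ≤ 64 * (E ^ 2) ^ 2 * (Fintype.card V : ℝ) ^ 2 / (k : ℝ) ^ 3) :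
    (#(packingLists (V := V) k m) : ℝ) * E ^ (m * k) ≤
      ((Fintype.card V).choose k * Real.exp (3 * k)) ^ m := by
  have hB : 1 ≤ E ^ 2 := one_le_pow₀ hE
  have hk0 : (0 : ℝ) < k := by linarith
  have hkV' : k ≤ Fintype.card V := by nlinarith
  set δ : ℝ := 16 * (E ^ 2) ^ 2 * Fintype.card V / (k : ℝ) ^ 2 with hδ
  refine le_trans ?_ (sum_pow_heavyHits_le (V := V) (k := k) (m := m) (δ := δ) (by positivity)
    (by positivity) fun t ht l hl => sum_extensions_heavyVertices_le hB hk hkV' hl (hm' t ht))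
  rw [← nsmul_eq_mul]
  refine card_nsmul_le_sum _ _ _ fun l hl => ?_
  rw [← pow_mul]
  refine pow_le_pow_right₀ hE ?_
  have h1 := sum_le_sum fun v (_ : v ∈ univ) =>
    coverDegree_le_heavyHits_add (δ := δ) (by positivity) l v
  rw [sum_add_distrib, sum_const, card_univ, nsmul_eq_mul, ← Nat.cast_sum, ← Nat.cast_sum,
    sum_coverDegree hl] at h1
  set n : ℝ := (Fintype.card V : ℝ) with hn
  have hkn : 4 * (k : ℝ) ^ 2 ≤ n := by
    rw [hn]
    exact_mod_cast hkV
  have h2 : 64 * (E ^ 2) ^ 2 * n ^ 2 / (k : ℝ) ^ 2 ≤ m * k := by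
    rw [div_le_iff₀ (by positivity)] at hm ⊢
    linarith
  have h3 : n * δ ≤ m * k / 4 := by
    refine le_trans (le_of_eq ?_) (div_le_div_of_nonneg_right h2 (by norm_num))
    rw [hδ]
    ring
  have h4 : n ≤ m * k / 4 := by
    refine le_trans ?_ h3
    have : 1 ≤ δ := by
      rw [hδ, le_div_iff₀ (by positivity)]
      have : 1 ≤ (E ^ 2) ^ 2 := one_le_pow₀ hB
      have hn0 : 0 ≤ n := by positivity
      nlinarith
    have hn0 : 0 ≤ n := by positivity
    nlinarith
  have h5 : ((m * k : ℕ) : ℝ) ≤ ((2 * ∑ v, heavyHits δ l v : ℕ) : ℝ) := by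
    push_cast at h1 ⊢
    linarith
  exact_mod_cast h5

theorem mul_choose_two_le_card_edgeFinset_coverGraph {k t : ℕ} {l : List (Finset V)}
    (hl : l ∈ packingLists k t) : t * k.choose 2 ≤ #(coverGraph l).edgeFinset := by
  obtain ⟨hlen, hcard, hpw⟩ := mem_packingLists.1 hl
  clear hl
  induction l generalizing t with
  | nil => simp [← hlen]
  | cons A l ih =>
    rw [List.pairwise_cons] at hpw
    rw [List.forall_mem_cons] at hcard
    have hdisj : Disjoint (coverGraph l).edgeFinset (A.offDiag.image Sym2.mk.uncurry) := by
      refine disjoint_left.2 fun e he he' => ?_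
      obtain ⟨⟨u, v⟩, huv, rfl⟩ := mem_image.1 he'
      rw [mem_offDiag] at huv
      rw [SimpleGraph.mem_edgeFinset] at he
      obtain ⟨-, B, hB, huB, hvB⟩ := he
      refine absurd (hpw.1 B hB) (not_le.2 (one_lt_card.2 ⟨u, ?_, v, ?_, huv.2.2⟩))
      · exact mem_inter.2 ⟨huv.1, huB⟩
      · exact mem_inter.2 ⟨huv.2.1, hvB⟩
    have hsub : (coverGraph l).edgeFinset ∪ A.offDiag.image Sym2.mk.uncurry ⊆
        (coverGraph (A :: l)).edgeFinset := by
      refine union_subset ?_ fun e he => ?_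
      · refine SimpleGraph.edgeFinset_mono fun u v h => ?_
        exact ⟨h.1, h.2.imp fun B hB => ⟨List.mem_cons_of_mem _ hB.1, hB.2⟩⟩
      · obtain ⟨⟨u, v⟩, huv, rfl⟩ := mem_image.1 he
        rw [mem_offDiag] at huv
        rw [SimpleGraph.mem_edgeFinset]
        exact ⟨huv.2.2, A, List.mem_cons_self, huv.1, huv.2.1⟩
    have h := card_le_card hsub
    rw [card_union_of_disjoint hdisj, Sym2.card_image_offDiag, hcard.1] at h
    have h2 := ih rfl hcard.2 hpw.2
    rw [← hlen, List.length_cons, Nat.add_mul, one_mul]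
    omega

/-- At most a `2^{-e(H)}` proportion of graphs contain a given graph `H`. -/
theorem card_supergraphs_mul_two_pow_le (H : SimpleGraph V) [DecidableRel H.Adj] :
    Nat.card {G : SimpleGraph V // H ≤ G} * 2 ^ #H.edgeFinset ≤ Nat.card (SimpleGraph V) := by
  have hT : Nat.card {T // T ∈ H.edgeFinset.powerset} = 2 ^ #H.edgeFinset := by
    rw [Nat.card_eq_fintype_card, Fintype.card_coe, card_powerset]
  rw [← hT, ← Nat.card_prod]
  refine Nat.card_le_card_of_injective
    (fun p => p.1.1.deleteEdges (p.2.1 : Set (Sym2 V))) ?_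
  rintro ⟨⟨G, hG⟩, T, hT⟩ ⟨⟨G', hG'⟩, T', hT'⟩ h
  have hE : G.edgeSet \ (T : Set (Sym2 V)) = G'.edgeSet \ (T' : Set (Sym2 V)) := by
    simpa [SimpleGraph.edgeSet_deleteEdges] using congrArg SimpleGraph.edgeSet h
  have hs : ∀ e ∈ H.edgeSet, e ∈ G.edgeSet ∧ e ∈ G'.edgeSet := fun e he =>
    ⟨SimpleGraph.edgeSet_mono hG he, SimpleGraph.edgeSet_mono hG' he⟩
  have hmem : ∀ e, (e ∈ G.edgeSet ∧ e ∉ T) ↔ (e ∈ G'.edgeSet ∧ e ∉ T') := fun e => by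
    simpa using Set.ext_iff.1 hE e
  have hTH : ∀ e ∈ T, e ∈ H.edgeSet := fun e he =>
    SimpleGraph.mem_edgeFinset.1 (mem_powerset.1 hT he)
  have hTH' : ∀ e ∈ T', e ∈ H.edgeSet := fun e he =>
    SimpleGraph.mem_edgeFinset.1 (mem_powerset.1 hT' he)
  have hGG : G = G' := by
    rw [← SimpleGraph.edgeSet_inj]
    ext e
    constructor
    · intro he
      by_cases heT : e ∈ T
      · exact (hs e (hTH e heT)).2
      · exact ((hmem e).1 ⟨he, heT⟩).1
    · intro he
      by_cases heT : e ∈ T'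
      · exact (hs e (hTH' e heT)).1
      · exact ((hmem e).2 ⟨he, heT⟩).1
  have hTT : T = T' := by
    ext e
    constructor
    · intro he
      by_contra hne
      exact ((hmem e).2 ⟨(hs e (hTH e he)).2, hne⟩).2 he
    · intro he
      by_contra hne
      exact ((hmem e).1 ⟨(hs e (hTH' e he)).1, hne⟩).2 he
  subst hGG hTT
  rfl

theorem exists_packingLists_of_lt_nuPack {n k m : ℕ} {G : SimpleGraph (Fin n)}
    (h : m ≤ nuPack n k G) : ∃ l ∈ packingLists k m, coverGraph l ≤ G := by
  have hmem : nuPack n k G ∈ {m | ∃ P, IsCliquePacking n k G P ∧ P.card = m} := by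
    refine Nat.sSup_mem ⟨0, ∅, ?_, card_empty⟩ ⟨Fintype.card (Finset (Fin n)), ?_⟩
    · exact ⟨by simp, by simp⟩
    · rintro _ ⟨P, -, rfl⟩
      exact card_le_univ P
  obtain ⟨P, hP, hcard⟩ := hmem
  rw [← hcard] at h
  obtain ⟨Q, hQP, hQ⟩ := exists_subset_card_eq h
  refine ⟨Q.toList, mem_packingLists.2 ⟨by simp [hQ], ?_, ?_⟩, coverGraph_le ?_⟩
  · intro A hA
    exact (hP.1 A (hQP (mem_toList.1 hA))).1
  · refine Q.nodup_toList.imp_of_mem fun {A B} hA hB hne => ?_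
    exact hP.2 A (hQP (mem_toList.1 hA)) B (hQP (mem_toList.1 hB)) hne
  · intro A hA
    exact (hP.1 A (hQP (mem_toList.1 hA))).2

theorem prGraph_le_nuPack_le (n k m : ℕ) :
    prGraph n (fun G => m ≤ nuPack n k G) ≤
      #(packingLists (V := Fin n) k m) / 2 ^ (m * k.choose 2) := by
  classical
  have hpos : 0 < Nat.card (SimpleGraph (Fin n)) := Nat.card_pos
  rw [prGraph, div_le_div_iff₀ (by exact_mod_cast hpos) (by positivity)]
  have h1 : Nat.card {G : SimpleGraph (Fin n) // m ≤ nuPack n k G} ≤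
      ∑ l ∈ packingLists (V := Fin n) k m,
        Nat.card {G : SimpleGraph (Fin n) // coverGraph l ≤ G} := by
    simp only [Nat.card_eq_fintype_card, Fintype.card_subtype]
    refine le_trans (card_le_card fun G hG => ?_) card_biUnion_le
    rw [mem_filter] at hG
    obtain ⟨l, hl, hlG⟩ := exists_packingLists_of_lt_nuPack hG.2
    exact mem_biUnion.2 ⟨l, hl, mem_filter.2 ⟨mem_univ _, hlG⟩⟩
  have h2 : Nat.card {G : SimpleGraph (Fin n) // m ≤ nuPack n k G} * 2 ^ (m * k.choose 2) ≤
      #(packingLists (V := Fin n) k m) * Nat.card (SimpleGraph (Fin n)) := by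
    refine (Nat.mul_le_mul_right _ h1).trans ?_
    rw [sum_mul, ← smul_eq_mul (a := #(packingLists (V := Fin n) k m))]
    refine sum_le_card_nsmul _ _ _ fun l hl => ?_
    refine le_trans (Nat.mul_le_mul_left _ (Nat.pow_le_pow_right two_pos ?_))
      (card_supergraphs_mul_two_pow_le (coverGraph l))
    exact mul_choose_two_le_card_edgeFinset_coverGraph hl
  exact_mod_cast h2

theorem prGraph_mono {n : ℕ} {p q : SimpleGraph (Fin n) → Prop} (h : ∀ G, p G → q G) :
    prGraph n p ≤ prGraph n q := by
  unfold prGraph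
  gcongr
  exact Nat.card_le_card_of_injective (Subtype.map id h) (Subtype.map_injective h fun _ _ => id)

end Counting

/-- For each positive integer `C` there are `D > 0` and `N` such that for all `n ≥ N`,
with `k = k₀(n) - C`, we have `P(ν_k(G_{n,1/2}) > D n²/k³) < exp(-n²/k²)`. -/
theorem stmt0 (C : ℕ) (hC : 0 < C) :
    ∃ D : ℝ, 0 < D ∧ ∃ N : ℕ, ∀ n, N ≤ n →
      prGraph n (fun G =>
          D * (n : ℝ) ^ 2 / ((kZero n - C : ℕ) : ℝ) ^ 3 < (nuPack n (kZero n - C) G : ℝ)) <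
        Real.exp (-((n : ℝ) ^ 2 / ((kZero n - C : ℕ) : ℝ) ^ 2)) := by
  set E : ℝ := Real.exp 4 * 4 ^ C with hE
  have hE1 : 1 ≤ E := one_le_mul_of_one_le_of_one_le (Real.one_le_exp (by norm_num))
    (one_le_pow₀ (by norm_num))
  have hE4 : 1 ≤ 64 * (E ^ 2) ^ 2 := by
    have : 1 ≤ (E ^ 2) ^ 2 := one_le_pow₀ (one_le_pow₀ hE1)
    linarith
  obtain ⟨N, hN⟩ := kZero_bounds (2 * C + ⌈8 * E ^ 2⌉₊)
  refine ⟨64 * (E ^ 2) ^ 2, by positivity, N, fun n hn => ?_⟩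
  obtain ⟨hJ, hsq, hf⟩ := hN n hn
  obtain ⟨k, hk⟩ : ∃ k, k = kZero n - C := ⟨_, rfl⟩
  rw [← hk]
  have hkC : k + C = kZero n := by omega
  have hCk : C ≤ k := by omega
  have hk0 : 0 < k := by omega
  rw [← hkC] at hf hsq
  have hk8 : 8 * E ^ 2 ≤ k := (Nat.le_ceil _).trans (by exact_mod_cast (by omega))
  have hkn : 4 * k ^ 2 ≤ n := le_trans (by gcongr; omega) hsq
  have hn0 : 0 < n := by nlinarith
  have hk0' : (0 : ℝ) < k := by exact_mod_cast hk0
  have hn0' : (0 : ℝ) < n := by exact_mod_cast hn0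
  set M : ℝ := 64 * (E ^ 2) ^ 2 * (n : ℝ) ^ 2 / (k : ℝ) ^ 3 with hM
  have hM0 : 0 ≤ M := by positivity
  set m : ℕ := ⌊M⌋₊ + 1 with hm
  have hMm : M < m := by
    rw [hm]
    exact_mod_cast Nat.lt_floor_add_one M
  have hfk : fExp n k ≤ (4 ^ C) ^ k := by
    have h2 : 2 * (k + C) ≤ n := by nlinarith
    calc fExp n k ≤ 2 ^ (C * (k + C)) * fExp n (k + C) := fExp_le_two_pow_mul_fExp_add C h2
      _ ≤ 2 ^ (C * (k + C)) * 1 := by gcongr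
      _ ≤ 2 ^ (C * (2 * k)) := by
          rw [mul_one]
          refine pow_le_pow_right₀ one_le_two (Nat.mul_le_mul_left _ (by omega))
      _ = (4 ^ C) ^ k := by
          rw [← pow_mul, show (4 : ℝ) = 2 ^ 2 by norm_num, ← pow_mul]
          ring_nf
  have hcount := card_packingLists_mul_le (V := Fin n) (k := k) (m := m) hE1 hk8
    (by simpa using hkn) (by simpa using hMm.le) fun t ht => by
      simpa using (Nat.le_floor_iff hM0).1 (Nat.lt_succ_iff.1 ht)
  rw [Fintype.card_fin] at hcount
  calc _ ≤ prGraph n (fun G => m ≤ nuPack n k G) :=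
        prGraph_mono fun G hG => Nat.succ_le_of_lt ((Nat.floor_lt hM0).2 hG)
    _ ≤ (packingLists (V := Fin n) k m).card / 2 ^ (m * k.choose 2) := prGraph_le_nuPack_le n k m
    _ ≤ (n.choose k * Real.exp (3 * k)) ^ m / E ^ (m * k) / 2 ^ (m * k.choose 2) := by
        gcongr
        rwa [le_div_iff₀ (by positivity)]
    _ = (fExp n k * Real.exp (3 * k) / E ^ k) ^ m := by
        rw [fExp, mul_comm m k, mul_comm m, pow_mul, pow_mul, ← div_pow, ← div_pow]
        congr 1
        field_simp
    _ ≤ Real.exp (-k) ^ m := by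
        have : 0 ≤ fExp n k := by unfold fExp; positivity
        gcongr
        rw [div_le_iff₀ (by positivity), hE, mul_pow, ← Real.exp_nat_mul, ← mul_assoc,
          ← Real.exp_add, mul_comm, show -(k : ℝ) + k * 4 = 3 * k by ring]
        gcongr
    _ = Real.exp (-(m * k)) := by rw [← Real.exp_nat_mul, mul_neg]
    _ < _ := by
        rw [Real.exp_lt_exp, neg_lt_neg_iff]
        calc (n : ℝ) ^ 2 / (k : ℝ) ^ 2 ≤ M * k := by
              rw [hM, div_mul_eq_mul_div, div_le_div_iff₀ (by positivity) (by positivity)]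
              have : 0 ≤ (n : ℝ) ^ 2 * (k : ℝ) ^ 3 := by positivity
              nlinarith
          _ < m * k := by gcongr
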